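/- arXiv:0804.3920 — 2 statements merged into one kernel-verified Lean document; each statement's English description precedes it below -/
import Mathlib

section
/- Let a > 0 and let V : ℝ → ℝ be real-analytic, a-periodic (V(x+a) = V(x) for all x) and even (V(−x) = V(x) for all x). Let λ be a periodic eigenvalue of L = −d²/dx² − V and suppose the quantity k = Σ_{μ < λ, μ a periodic eigenvalue} dim E₀(μ) is finite, where E₀(μ) denotes the vector space of a-periodic C^∞ solutions of f'' + (V + μ)f = 0 (so λ occupies position j = k + 1 in the spectrum counted with multiplicity). Then every periodic eigenfunction for λ has exactly 2⌊(k+1)/2⌋ zeros in [0,a); equivalently, writing j = k+1, it has exactly j nodes if j is even and exactly j − 1 nodes if j is odd. -/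
/-- `f` is a periodic eigenfunction of `L = -d²/dx² - V` with eigenvalue `lam`:
a nonzero `C^∞` `a`-periodic function on `ℝ` satisfying `f'' + (V + lam) f = 0`. -/
def IsPeriodicEigenfunction (a : ℝ) (V : ℝ → ℝ) (lam : ℝ) (f : ℝ → ℝ) : Prop :=
  ContDiff ℝ (⊤ : ℕ∞) f ∧ f ≠ 0 ∧
    (∀ x : ℝ, deriv (deriv f) x + (V x + lam) * f x = 0) ∧ ∀ x : ℝ, f (x + a) = f x

/-- The dimension of the eigenspace `E₀(μ)` of `a`-periodic smooth solutions of
`u'' + (V + μ) u = 0`.  (The solution set is a linear subspace, so it equals its span.) -/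
noncomputable def dimE0 (a : ℝ) (V : ℝ → ℝ) (μ : ℝ) : ℕ :=
  Module.finrank ℝ ↥(Submodule.span ℝ
    {u : ℝ → ℝ | ContDiff ℝ (⊤ : ℕ∞) u ∧
      (∀ x : ℝ, deriv (deriv u) x + (V x + μ) * u x = 0) ∧ ∀ x : ℝ, u (x + a) = u x})

open Real Set Filter Topology

/-- The right-hand side of the Prüfer phase equation `θ' = cos² θ + q sin² θ` associated with
`u'' + q u = 0`. -/
noncomputable def pruferField (q θ : ℝ) : ℝ := cos θ ^ 2 + q * sin θ ^ 2

/-- `θ` is a Prüfer phase of the equation `u'' + Q u = 0`. -/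
def IsPruferPhase (Q θ : ℝ → ℝ) : Prop := ∀ t, HasDerivAt θ (pruferField (Q t) (θ t)) t

lemma pruferField_sub (q w θ : ℝ) :
    pruferField q w - pruferField q θ = (q - 1) * sin (w - θ) * sin (w + θ) := by
  simp only [pruferField, sin_sub, sin_add]
  linear_combination (1 + (q - 1) * sin θ ^ 2) * cos_sq' w - (1 + (q - 1) * sin w ^ 2) * cos_sq' θ

lemma lipschitzWith_pruferField {q : ℝ} {K : NNReal} (hK : |q - 1| ≤ K) :
    LipschitzWith K (pruferField q) := by
  refine LipschitzWith.of_dist_le_mul fun w θ => ?_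
  rw [Real.dist_eq, Real.dist_eq, pruferField_sub, abs_mul, abs_mul]
  have h1 : |sin (w - θ)| ≤ |w - θ| := abs_sin_le_abs
  have h2 : |sin (w + θ)| ≤ 1 := abs_sin_le_one _
  calc |q - 1| * |sin (w - θ)| * |sin (w + θ)| ≤ K * |w - θ| * 1 := by gcongr
    _ = _ := mul_one _

lemma abs_pruferField_le (q θ : ℝ) : |pruferField q θ| ≤ 1 + |q - 1| := by
  have h : pruferField q θ = 1 + (q - 1) * sin θ ^ 2 := by
    simp only [pruferField]; linear_combination sin_sq_add_cos_sq θ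
  rw [h]
  refine (abs_add_le _ _).trans ?_
  rw [abs_one, abs_mul, abs_of_nonneg (sq_nonneg (sin θ))]
  nlinarith [abs_nonneg (q - 1), sin_sq_le_one θ]

/-- A continuous potential has Lipschitz Prüfer field uniformly on compact intervals. -/
lemma exists_bound_on_Icc {Q : ℝ → ℝ} (hQ : Continuous Q) (s t : ℝ) :
    ∃ K : NNReal, ∀ x ∈ Icc s t, |Q x - 1| ≤ K := by
  obtain ⟨C, hC⟩ := (isCompact_Icc (a := s) (b := t)).exists_bound_of_continuousOn
    (f := fun x => Q x - 1) (by fun_prop)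
  exact ⟨C.toNNReal, fun x hx => (hC x hx).trans (Real.le_coe_toNNReal C)⟩

lemma exists_pruferPhase_on_Icc {Q : ℝ → ℝ} (hQ : Continuous Q) (θ₀ : ℝ) {T : ℝ} (hT : 0 ≤ T) :
    ∃ θ : ℝ → ℝ, θ 0 = θ₀ ∧
      ∀ t ∈ Icc (-T) T, HasDerivWithinAt θ (pruferField (Q t) (θ t)) (Icc (-T) T) t := by
  obtain ⟨K, hK⟩ := exists_bound_on_Icc hQ (-T) T
  have h0 : (0 : ℝ) ∈ Icc (-T) T := by constructor <;> linarith
  have := IsPicardLindelof.exists_eq_forall_mem_Icc_hasDerivWithinAt₀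
    (f := fun t θ => pruferField (Q t) θ) (tmin := -T) (tmax := T) (t₀ := ⟨0, h0⟩) (x₀ := θ₀)
    (a := (1 + K) * T.toNNReal) (L := 1 + K) (K := K)
    { lipschitzOnWith := fun t ht => (lipschitzWith_pruferField (hK t ht)).lipschitzOnWith
      continuousOn := fun x _ => by unfold pruferField; fun_prop
      norm_le := fun t ht x _ => (abs_pruferField_le _ _).trans <| by
        push_cast; linarith [hK t ht]
      mul_max_le := by simp [hT] }
  simpa using this

lemma exists_pruferPhase {Q : ℝ → ℝ} (hQ : Continuous Q) (θ₀ : ℝ) :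
    ∃ θ, IsPruferPhase Q θ ∧ θ 0 = θ₀ := by
  choose Θ h0 hd using fun n : ℕ =>
    exists_pruferPhase_on_Icc hQ θ₀ (T := (n : ℝ) + 1) (by positivity)
  have hd' : ∀ n : ℕ, ∀ t ∈ Ioo (-((n : ℝ) + 1)) (n + 1),
      HasDerivAt (Θ n) (pruferField (Q t) (Θ n t)) t := fun n t ht =>
    (hd n t (Ioo_subset_Icc_self ht)).hasDerivAt (Icc_mem_nhds ht.1 ht.2)
  have heq : ∀ n m : ℕ, n ≤ m → EqOn (Θ n) (Θ m) (Ioo (-((n : ℝ) + 1)) (n + 1)) := by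
    intro n m hnm
    have hnm' : (n : ℝ) ≤ m := by exact_mod_cast hnm
    obtain ⟨K, hK⟩ := exists_bound_on_Icc hQ (-((n : ℝ) + 1)) (n + 1)
    exact ODE_solution_unique_of_mem_Ioo (v := fun t θ => pruferField (Q t) θ) (s := fun _ => univ)
      (K := K) (t₀ := 0)
      (fun t ht => (lipschitzWith_pruferField (hK t (Ioo_subset_Icc_self ht))).lipschitzOnWith)
      ⟨by linarith [n.cast_nonneg (α := ℝ)], by positivity⟩
      (fun t ht => ⟨hd' n t ht, mem_univ _⟩)
      (fun t ht => ⟨hd' m t ⟨by linarith [ht.1], by linarith [ht.2]⟩, mem_univ _⟩)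
      ((h0 n).trans (h0 m).symm)
  refine ⟨fun t => Θ ⌈|t|⌉₊ t, fun t => ?_, by simp [h0]⟩
  have key : ∀ s, |s| < (⌈|t|⌉₊ : ℝ) + 1 → Θ ⌈|s|⌉₊ s = Θ ⌈|t|⌉₊ s := by
    intro s hs
    rcases le_total ⌈|s|⌉₊ ⌈|t|⌉₊ with h | h
    · exact heq _ _ h (abs_lt.1 ((Nat.le_ceil _).trans_lt (lt_add_one _)))
    · exact (heq _ _ h (abs_lt.1 hs)).symm
  have ht : |t| < (⌈|t|⌉₊ : ℝ) + 1 := (Nat.le_ceil _).trans_lt (lt_add_one _)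
  refine (hd' ⌈|t|⌉₊ t (abs_lt.1 ht)).congr_of_eventuallyEq ?_
  filter_upwards [continuous_abs.continuousAt.eventually (gt_mem_nhds ht)] with s hs
  exact key s hs

/-- Integrating factor for a continuous coefficient. -/
lemma exists_integrating_factor {h : ℝ → ℝ} (hh : Continuous h) :
    ∃ E : ℝ → ℝ, (∀ t, 0 < E t) ∧ ∀ t, HasDerivAt E (h t * E t) t := by
  refine ⟨fun t => exp (∫ s in (0 : ℝ)..t, h s), fun t => exp_pos _, fun t => ?_⟩
  have := (intervalIntegral.integral_hasDerivAt_right (hh.intervalIntegrable 0 t)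
    hh.aestronglyMeasurable.stronglyMeasurableAtFilter hh.continuousAt).exp
  rwa [mul_comm] at this

/-- A solution of `g' = h g` is a nonvanishing function times a constant. -/
lemma eq_mul_of_linear {h g E : ℝ → ℝ} (hE : ∀ t, 0 < E t) (hE' : ∀ t, HasDerivAt E (h t * E t) t)
    (hg : ∀ t, HasDerivAt g (h t * g t) t) : ∃ C, ∀ t, g t = C * E t := by
  have hd : ∀ t, HasDerivAt (fun t => g t / E t) 0 t := fun t => by
    exact ((hg t).div (hE' t) (hE t).ne').congr_deriv (by ring)
  refine ⟨g 0 / E 0, fun t => ?_⟩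
  have := is_const_of_deriv_eq_zero (fun t => (hd t).differentiableAt) (fun t => (hd t).deriv) t 0
  rw [← this]
  exact (div_mul_cancel₀ _ (hE t).ne').symm

/-- The difference of two functions, compared through the Prüfer field, satisfies a scalar linear
equation; this is its integrating factor. -/
lemma exists_comparison_factor {Q θ w θ' w' : ℝ → ℝ} (hQ : Continuous Q)
    (hθ : ∀ t, HasDerivAt θ (θ' t) t) (hw : ∀ t, HasDerivAt w (w' t) t) :
    ∃ E : ℝ → ℝ, (∀ t, 0 < E t) ∧ ∀ t, HasDerivAt (fun t => (w t - θ t) * E t)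
      (((w' t - pruferField (Q t) (w t)) - (θ' t - pruferField (Q t) (θ t))) * E t) t := by
  have cθ : Continuous θ := continuous_iff_continuousAt.2 fun t => (hθ t).continuousAt
  have cw : Continuous w := continuous_iff_continuousAt.2 fun t => (hw t).continuousAt
  have cs := continuous_sinc
  obtain ⟨E, hE, hE'⟩ := exists_integrating_factor
    (h := fun t => -((Q t - 1) * sinc (w t - θ t) * sin (w t + θ t))) (by fun_prop)
  refine ⟨E, hE, fun t => ?_⟩
  have h1 : sin (w t - θ t) = sinc (w t - θ t) * (w t - θ t) := by
    by_cases h : w t - θ t = 0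
    · simp [h]
    · rw [sinc_of_ne_zero h]; field_simp
  have h2 := pruferField_sub (Q t) (w t) (θ t)
  rw [h1] at h2
  exact (((hw t).sub (hθ t)).mul (hE' t)).congr_deriv
    (by rw [Pi.sub_apply]; linear_combination E t * h2)

/-- Comparison principle for the Prüfer field: a function `w` with residual at least that of `θ`,
starting above `θ`, stays above `θ`, strictly so if one of the inequalities is strict. -/
lemma pruferField_comparison {Q θ w θ' w' : ℝ → ℝ} (hQ : Continuous Q)
    (hθ : ∀ t, HasDerivAt θ (θ' t) t) (hw : ∀ t, HasDerivAt w (w' t) t) {s T : ℝ} (hsT : s < T)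
    (hres : ∀ t ∈ Icc s T,
      θ' t - pruferField (Q t) (θ t) ≤ w' t - pruferField (Q t) (w t))
    (hs : θ s ≤ w s)
    (hstrict : θ s < w s ∨ ∃ t ∈ Ioo s T,
      θ' t - pruferField (Q t) (θ t) < w' t - pruferField (Q t) (w t)) : θ T < w T := by
  obtain ⟨E, hE, hd⟩ := exists_comparison_factor hQ hθ hw
  have hmono : MonotoneOn (fun t => (w t - θ t) * E t) (Icc s T) :=
    monotoneOn_of_hasDerivWithinAt_nonneg (convex_Icc s T)
      (fun t _ => (hd t).continuousAt.continuousWithinAt)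
      (fun t _ => (hd t).hasDerivWithinAt)
      (fun t ht => mul_nonneg (sub_nonneg.2 (hres t (interior_subset ht))) (hE t).le)
  have h0 : 0 ≤ (w s - θ s) * E s := mul_nonneg (sub_nonneg.2 hs) (hE s).le
  by_contra! hT
  have hT' : (w T - θ T) * E T ≤ 0 := mul_nonpos_of_nonpos_of_nonneg (sub_nonpos.2 hT) (hE T).le
  have hzero : ∀ t ∈ Icc s T, (w t - θ t) * E t = 0 := fun t ht =>
    le_antisymm ((hmono ht (right_mem_Icc.2 hsT.le) ht.2).trans hT')
      (h0.trans (hmono (left_mem_Icc.2 hsT.le) ht ht.1))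
  rcases hstrict with h | ⟨t, ht, h⟩
  · exact (mul_pos (sub_pos.2 h) (hE s)).ne' (hzero s (left_mem_Icc.2 hsT.le))
  · have hloc : (fun t => (w t - θ t) * E t) =ᶠ[𝓝 t] fun _ => 0 := by
      filter_upwards [Icc_mem_nhds ht.1 ht.2] with x hx using hzero x hx
    exact (mul_pos (sub_pos.2 h) (hE t)).ne'
      ((hd t).unique ((hasDerivAt_const t (0 : ℝ)).congr_of_eventuallyEq hloc))

lemma IsPruferPhase.continuous {Q θ : ℝ → ℝ} (hθ : IsPruferPhase Q θ) : Continuous θ :=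
  continuous_iff_continuousAt.2 fun t => (hθ t).continuousAt

lemma IsPruferPhase.eq_of_eq {Q θ w : ℝ → ℝ} (hQ : Continuous Q) (hθ : IsPruferPhase Q θ)
    (hw : IsPruferPhase Q w) {t₀ : ℝ} (h : θ t₀ = w t₀) : θ = w := by
  obtain ⟨E, hE, hd⟩ := exists_comparison_factor hQ hθ hw
  simp only [sub_self, zero_mul] at hd
  funext t
  have := is_const_of_deriv_eq_zero (fun t => (hd t).differentiableAt) (fun t => (hd t).deriv) t t₀
  simp only [h, sub_self, zero_mul, mul_eq_zero, (hE t).ne', or_false] at this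
  linarith

lemma IsPruferPhase.lt_of_lt {Q θ w : ℝ → ℝ} (hQ : Continuous Q) (hθ : IsPruferPhase Q θ)
    (hw : IsPruferPhase Q w) {s t : ℝ} (hst : s ≤ t) (h : θ s < w s) : θ t < w t := by
  rcases hst.eq_or_lt with rfl | hst
  · exact h
  · exact pruferField_comparison hQ hθ hw hst (fun _ _ => by simp) h.le (Or.inl h)

lemma pruferField_add_int_mul_pi (q θ : ℝ) (n : ℤ) :
    pruferField q (θ + n * π) = pruferField q θ := by
  have h1 : sin (θ + n * π) ^ 2 = sin θ ^ 2 := by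
    rw [sin_add_int_mul_pi, mul_pow, ← zpow_natCast, ← zpow_mul, mul_comm n, zpow_mul]
    simp
  simp only [pruferField, cos_sq', h1]

lemma IsPruferPhase.add_int_mul_pi {Q θ : ℝ → ℝ} (hθ : IsPruferPhase Q θ) (n : ℤ) :
    IsPruferPhase Q (fun t => θ t + n * π) := fun t => by
  rw [pruferField_add_int_mul_pi]; exact (hθ t).add_const _

lemma IsPruferPhase.reflect {Q θ : ℝ → ℝ} (hθ : IsPruferPhase Q θ) {p : ℝ}
    (hp : ∀ t, Q (p - t) = Q t) (n : ℤ) :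
    IsPruferPhase Q (fun t => n * π - θ (p - t)) := fun t => by
  have h : HasDerivAt (fun t => θ (p - t)) (-pruferField (Q t) (θ (p - t))) t := by
    have := (hθ (p - t)).comp_const_sub p t
    rwa [hp] at this
  have h2 : pruferField (Q t) (n * π - θ (p - t)) = pruferField (Q t) (θ (p - t)) := by
    rw [sub_eq_neg_add, pruferField_add_int_mul_pi]; simp [pruferField]
  rw [h2]
  simpa using h.const_sub (n * π)

/-- A Prüfer phase crosses integer multiples of `π` only upwards. -/
lemma IsPruferPhase.int_mul_pi_lt {Q θ : ℝ → ℝ} (hQ : Continuous Q) (hθ : IsPruferPhase Q θ)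
    {s t : ℝ} (hst : s < t) (n : ℤ) (h : n * π ≤ θ s) : n * π < θ t := by
  have hval : ∀ q, pruferField q (n * π) = 1 := fun q => by
    have := pruferField_add_int_mul_pi q 0 n
    simpa [pruferField] using this
  refine pruferField_comparison (θ := fun _ => n * π) (θ' := fun _ => 0) hQ
    (fun _ => hasDerivAt_const _ _) hθ hst (fun x _ => by simp [hval]) h
    (Or.inr ⟨(s + t) / 2, ⟨by linarith, by linarith⟩, by simp [hval]⟩)

/-- Strict monotonicity of the Prüfer phase in the spectral parameter. -/
lemma IsPruferPhase.lt_of_potential_lt {V θ w : ℝ → ℝ} (hV : Continuous V) {μ ν : ℝ} (hμν : μ < ν)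
    (hθ : IsPruferPhase (fun t => V t + μ) θ) (hw : IsPruferPhase (fun t => V t + ν) w)
    {s t : ℝ} (hst : s < t) (h : θ s = w s) : θ t < w t := by
  have hres : ∀ x, pruferField (V x + ν) (w x) - pruferField (V x + μ) (w x)
      = (ν - μ) * sin (w x) ^ 2 := fun x => by simp only [pruferField]; ring
  refine pruferField_comparison (Q := fun t => V t + μ) (by fun_prop) hθ hw hst
    (fun x _ => ?_) h.le (Or.inr ?_)
  · rw [hres, sub_self]
    exact mul_nonneg (sub_pos.2 hμν).le (sq_nonneg _)
  · by_contra! hcon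
    have hzero : ∀ x ∈ Ioo s t, sin (w x) = 0 := fun x hx => by
      have := hcon x hx
      rw [hres, sub_self] at this
      have h2 : 0 ≤ sin (w x) ^ 2 := sq_nonneg _
      have h3 : sin (w x) ^ 2 = 0 := by nlinarith
      simpa using h3
    have hx : (s + t) / 2 ∈ Ioo s t := ⟨by linarith, by linarith⟩
    have hloc : (fun x => sin (w x)) =ᶠ[𝓝 ((s + t) / 2)] fun _ => 0 := by
      filter_upwards [Ioo_mem_nhds hx.1 hx.2] with x hx using hzero x hx
    have hd := (hw ((s + t) / 2)).sin.unique
      ((hasDerivAt_const _ (0 : ℝ)).congr_of_eventuallyEq hloc)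
    have h0 := hzero _ hx
    have h1 := sin_sq_add_cos_sq (w ((s + t) / 2))
    simp only [pruferField, h0] at hd h1
    have : cos (w ((s + t) / 2)) ^ 3 = 0 := by linarith
    have h4 : cos (w ((s + t) / 2)) = 0 := by simpa using this
    rw [h4] at h1
    norm_num at h1

/-- Continuity of the Prüfer phase in the spectral parameter. -/
lemma continuous_pruferPhase_param {V : ℝ → ℝ} (hV : Continuous V) {Θ : ℝ → ℝ → ℝ}
    (hΘ : ∀ μ, IsPruferPhase (fun t => V t + μ) (Θ μ)) {θ₀ : ℝ} (h0 : ∀ μ, Θ μ 0 = θ₀)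
    {c : ℝ} (hc : 0 ≤ c) : Continuous fun μ => Θ μ c := by
  refine continuous_iff_continuousAt.2 fun μ₀ => ?_
  obtain ⟨K, hK⟩ := exists_bound_on_Icc (Q := fun t => V t + μ₀) (by fun_prop) 0 c
  have hest : ∀ μ, dist (Θ μ c) (Θ μ₀ c) ≤ gronwallBound 0 K (|μ - μ₀| + 0) (c - 0) := fun μ =>
    dist_le_of_approx_trajectories_ODE_of_mem (v := fun t θ => pruferField (V t + μ₀) θ)
      (s := fun _ => univ) (f' := fun t => pruferField (V t + μ) (Θ μ t))
      (g' := fun t => pruferField (V t + μ₀) (Θ μ₀ t))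
      (fun t ht => (lipschitzWith_pruferField (hK t (Ico_subset_Icc_self ht))).lipschitzOnWith)
      (hΘ μ).continuous.continuousOn (fun t _ => (hΘ μ t).hasDerivWithinAt)
      (fun t _ => by
        have : pruferField (V t + μ) (Θ μ t) - pruferField (V t + μ₀) (Θ μ t)
          = (μ - μ₀) * sin (Θ μ t) ^ 2 := by simp only [pruferField]; ring
        rw [Real.dist_eq, this, abs_mul, abs_of_nonneg (sq_nonneg (sin _))]
        exact mul_le_of_le_one_right (abs_nonneg _) (sin_sq_le_one _))
      (fun _ _ => mem_univ _)
      (hΘ μ₀).continuous.continuousOn (fun t _ => (hΘ μ₀ t).hasDerivWithinAt)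
      (fun t _ => (dist_self _).le) (fun _ _ => mem_univ _) (by simp [h0]) c (right_mem_Icc.2 hc)
  refine tendsto_iff_dist_tendsto_zero.2 (squeeze_zero (fun _ => dist_nonneg) hest ?_)
  have hcont : Continuous fun μ => gronwallBound 0 K (|μ - μ₀| + 0) (c - 0) :=
    (gronwallBound_continuous_ε 0 K (c - 0)).comp (by fun_prop)
  have := hcont.tendsto μ₀
  simpa [gronwallBound_ε0_δ0] using this

/-- As the spectral parameter tends to `-∞`, a phase starting in `[0, π / 2]` tends to `0`. -/
lemma tendsto_pruferPhase_param_atBot {V : ℝ → ℝ} (hV : Continuous V) {Θ : ℝ → ℝ → ℝ}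
    (hΘ : ∀ μ, IsPruferPhase (fun t => V t + μ) (Θ μ)) {θ₀ : ℝ} (h0 : ∀ μ, Θ μ 0 = θ₀)
    (hθ₀ : 0 ≤ θ₀) (hθ₁ : θ₀ ≤ π / 2) {c : ℝ} (hc : 0 < c) :
    Tendsto (fun μ => Θ μ c) atBot (𝓝 0) := by
  have hπ := pi_pos
  refine tendsto_order.2 ⟨fun b hb => Eventually.of_forall fun μ => ?_, fun b hb => ?_⟩
  · have := (hΘ μ).int_mul_pi_lt (by fun_prop) hc 0 (by simpa [h0] using hθ₀)
    simp only [Int.cast_zero, zero_mul] at this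
    exact hb.trans this
  obtain ⟨ε, hε, hεb, hεπ⟩ : ∃ ε, 0 < ε ∧ ε ≤ b ∧ ε ≤ π / 4 :=
    ⟨min b (π / 4), lt_min hb (by positivity), min_le_left _ _, min_le_right _ _⟩
  obtain ⟨M, hM⟩ := exists_bound_on_Icc hV 0 c
  set σ := (3 * π / 4 - ε) / c with hσ
  have hσ0 : 0 < σ := div_pos (by linarith) hc
  have hσc : σ * c = 3 * π / 4 - ε := div_mul_cancel₀ _ hc.ne'
  have hsin : 0 < sin ε := sin_pos_of_pos_of_lt_pi hε (by linarith)
  filter_upwards [Iic_mem_atBot (-(M + 1 + (1 + σ) / sin ε ^ 2))] with μ hμ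
  have hμ' : M + 1 + μ ≤ -((1 + σ) / sin ε ^ 2) := by have := mem_Iic.1 hμ; linarith
  have key : Θ μ c < 3 * π / 4 - σ * c := by
    refine pruferField_comparison (Q := fun t => V t + μ) (w := fun t => 3 * π / 4 - σ * t)
      (w' := fun _ => -σ) (by fun_prop) (hΘ μ)
      (fun t => by simpa using ((hasDerivAt_id t).const_mul σ).const_sub (3 * π / 4)) hc
      (fun t ht => ?_) (by simp only [h0]; linarith) (Or.inl (by simp only [h0]; linarith))
    have hw1 : ε ≤ 3 * π / 4 - σ * t := by nlinarith [ht.2]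
    have hw2 : 3 * π / 4 - σ * t ≤ π - ε := by nlinarith [ht.1]
    have hs : sin ε ≤ sin (3 * π / 4 - σ * t) := by
      rcases le_total (3 * π / 4 - σ * t) (π / 2) with h | h
      · exact sin_le_sin_of_le_of_le_pi_div_two (by linarith) h hw1
      · rw [← sin_pi_sub (3 * π / 4 - σ * t)]
        exact sin_le_sin_of_le_of_le_pi_div_two (by linarith) (by linarith) (by linarith)
    have hs2 : sin ε ^ 2 ≤ sin (3 * π / 4 - σ * t) ^ 2 := by gcongr
    have hq : V t + μ ≤ -((1 + σ) / sin ε ^ 2) := by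
      have := (abs_le.1 (hM t ht)).2
      linarith
    have h3 : (1 + σ) / sin ε ^ 2 * sin ε ^ 2 = 1 + σ := div_mul_cancel₀ _ (by positivity)
    have hpos : 0 ≤ (1 + σ) / sin ε ^ 2 := by positivity
    have h4 : (V t + μ) * sin (3 * π / 4 - σ * t) ^ 2 ≤ -(1 + σ) := by
      calc _ ≤ -((1 + σ) / sin ε ^ 2) * sin (3 * π / 4 - σ * t) ^ 2 := by gcongr
        _ ≤ -(1 + σ) := by nlinarith
    have h5 := cos_sq_le_one (3 * π / 4 - σ * t)
    rw [sub_self]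
    simp only [pruferField]
    linarith
  linarith

/-- `(f, g)` solves the first-order system of `u'' + Q u = 0`, that is `f' = g`, `g' = -Q f`. -/
def IsHillSolution (Q f g : ℝ → ℝ) : Prop :=
  ∀ t, HasDerivAt f (g t) t ∧ HasDerivAt g (-(Q t * f t)) t

namespace IsHillSolution

variable {Q f g f₁ g₁ f₂ g₂ : ℝ → ℝ}

lemma smul_add_smul (h₁ : IsHillSolution Q f₁ g₁) (h₂ : IsHillSolution Q f₂ g₂) (α β : ℝ) :
    IsHillSolution Q (fun t => α * f₁ t + β * f₂ t) (fun t => α * g₁ t + β * g₂ t) := fun t =>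
  ⟨((h₁ t).1.const_mul α).add ((h₂ t).1.const_mul β),
    (((h₁ t).2.const_mul α).add ((h₂ t).2.const_mul β)).congr_deriv (by ring)⟩

lemma reflect (h : IsHillSolution Q f g) {p : ℝ} (hp : ∀ t, Q (p - t) = Q t) :
    IsHillSolution Q (fun t => f (p - t)) (fun t => -g (p - t)) := fun t =>
  ⟨(h (p - t)).1.comp_const_sub p t,
    ((h (p - t)).2.comp_const_sub p t).neg.congr_deriv (by rw [hp]; ring)⟩

end IsHillSolution

/-- Prüfer's polar coordinates: along a phase `θ` there is a positive amplitude `E` such that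
`E sin θ` is a solution, and every solution with phase `θ` at one point is a multiple of it. -/
lemma IsPruferPhase.exists_amplitude {Q θ : ℝ → ℝ} (hQ : Continuous Q) (hθ : IsPruferPhase Q θ) :
    ∃ E : ℝ → ℝ, (∀ t, 0 < E t) ∧
      IsHillSolution Q (fun t => E t * sin (θ t)) (fun t => E t * cos (θ t)) ∧
      ∀ f g, IsHillSolution Q f g → ∀ t₀, f t₀ * cos (θ t₀) = g t₀ * sin (θ t₀) →
        ∃ C, ∀ t, f t = C * (E t * sin (θ t)) ∧ g t = C * (E t * cos (θ t)) := by
  have cθ := hθ.continuous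
  obtain ⟨E, hE, hE'⟩ := exists_integrating_factor
    (h := fun t => (1 - Q t) * sin (θ t) * cos (θ t)) (by fun_prop)
  obtain ⟨D, hD, hD'⟩ := exists_integrating_factor
    (h := fun t => -((1 - Q t) * sin (θ t) * cos (θ t))) (by fun_prop)
  refine ⟨E, hE, fun t => ⟨?_, ?_⟩, fun f g hfg t₀ h₀ => ?_⟩
  · refine ((hE' t).mul (hθ t).sin).congr_deriv ?_
    simp only [pruferField]
    linear_combination E t * cos (θ t) * sin_sq_add_cos_sq (θ t)
  · refine ((hE' t).mul (hθ t).cos).congr_deriv ?_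
    simp only [pruferField]
    linear_combination (-E t * Q t * sin (θ t)) * sin_sq_add_cos_sq (θ t)
  · have hd₁ : ∀ t, HasDerivAt (fun t => f t * cos (θ t) - g t * sin (θ t))
        (-((1 - Q t) * sin (θ t) * cos (θ t)) * (f t * cos (θ t) - g t * sin (θ t))) t := by
      intro t
      refine (((hfg t).1.mul (hθ t).cos).sub ((hfg t).2.mul (hθ t).sin)).congr_deriv ?_
      simp only [pruferField]
      linear_combination (-g t * cos (θ t) - f t * Q t * sin (θ t)) * sin_sq_add_cos_sq (θ t)
    obtain ⟨C₁, hC₁⟩ := eq_mul_of_linear hD hD' hd₁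
    have hC₁' : C₁ = 0 := by
      have := hC₁ t₀
      rw [h₀, sub_self] at this
      simpa [(hD t₀).ne'] using this.symm
    have hzero : ∀ t, f t * cos (θ t) - g t * sin (θ t) = 0 := fun t => by
      rw [hC₁, hC₁', zero_mul]
    have hd₂ : ∀ t, HasDerivAt (fun t => f t * sin (θ t) + g t * cos (θ t))
        ((1 - Q t) * sin (θ t) * cos (θ t) * (f t * sin (θ t) + g t * cos (θ t))) t := by
      intro t
      refine (((hfg t).1.mul (hθ t).sin).add ((hfg t).2.mul (hθ t).cos)).congr_deriv ?_
      simp only [pruferField]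
      linear_combination (-(1 - Q t) * (sin (θ t) ^ 2 - cos (θ t) ^ 2)) * hzero t
        + (f t * cos (θ t) * Q t - g t * sin (θ t)) * sin_sq_add_cos_sq (θ t)
    obtain ⟨C, hC⟩ := eq_mul_of_linear hE hE' hd₂
    refine ⟨C, fun t => ⟨?_, ?_⟩⟩
    · linear_combination sin (θ t) * hC t + cos (θ t) * hzero t
        - f t * sin_sq_add_cos_sq (θ t)
    · linear_combination cos (θ t) * hC t - sin (θ t) * hzero t
        - g t * sin_sq_add_cos_sq (θ t)

lemma IsHillSolution.eq_zero {Q f g : ℝ → ℝ} (hQ : Continuous Q) (h : IsHillSolution Q f g)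
    {t₀ : ℝ} (hf : f t₀ = 0) (hg : g t₀ = 0) : ∀ t, f t = 0 := by
  obtain ⟨θ, hθ, -⟩ := exists_pruferPhase hQ 0
  obtain ⟨E, hE, -, hu⟩ := hθ.exists_amplitude hQ
  obtain ⟨C, hC⟩ := hu f g h t₀ (by simp [hf, hg])
  have hC0 : C = 0 := by
    have h1 := (hC t₀).1
    have h2 := (hC t₀).2
    rw [hf] at h1
    rw [hg] at h2
    have h3 : C * E t₀ = 0 := by
      linear_combination (-sin (θ t₀)) * h1 - cos (θ t₀) * h2
        - C * E t₀ * sin_sq_add_cos_sq (θ t₀)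
    simpa [(hE t₀).ne'] using h3
  intro t
  rw [(hC t).1, hC0, zero_mul]

section Symmetric

variable {Q : ℝ → ℝ} {a : ℝ}

/-- If the phase issued from `π / 2` satisfies the Neumann condition at the half period, there is an
even periodic solution. -/
lemma exists_periodic_of_neumann (hQ : Continuous Q) (hp₀ : ∀ t, Q (0 - t) = Q t)
    (hpa : ∀ t, Q (a - t) = Q t) {θ : ℝ → ℝ} (hθ : IsPruferPhase Q θ) (h0 : θ 0 = π / 2)
    (hc : cos (θ (a / 2)) = 0) :
    ∃ f g, IsHillSolution Q f g ∧ (∀ t, f (t + a) = f t) ∧ f 0 = 1 ∧ g 0 = 0 := by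
  obtain ⟨E, hE, hsol, -⟩ := hθ.exists_amplitude hQ
  have hr₀ := (hsol.smul_add_smul (hsol.reflect hp₀) 1 (-1)).eq_zero hQ (t₀ := 0)
    (by simp) (by simp [h0])
  have hra := (hsol.smul_add_smul (hsol.reflect hpa) 1 (-1)).eq_zero hQ (t₀ := a / 2)
    (by simp [sub_half]) (by simp [sub_half, hc])
  have hne := (hE 0).ne'
  refine ⟨_, _, hsol.smul_add_smul hsol (1 / E 0) 0, fun t => ?_, by simp [h0, hne], by simp [h0]⟩
  have h1 := hr₀ t
  have h2 := hra (t + a)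
  rw [show a - (t + a) = 0 - t by ring] at h2
  beta_reduce at h1 h2 ⊢
  linear_combination (1 / E 0) * (h2 - h1)

/-- If the phase issued from `0` satisfies the Dirichlet condition at the half period, there is an
odd periodic solution. -/
lemma exists_periodic_of_dirichlet (hQ : Continuous Q) (hp₀ : ∀ t, Q (0 - t) = Q t)
    (hpa : ∀ t, Q (a - t) = Q t) {θ : ℝ → ℝ} (hθ : IsPruferPhase Q θ) (h0 : θ 0 = 0)
    (hc : sin (θ (a / 2)) = 0) :
    ∃ f g, IsHillSolution Q f g ∧ (∀ t, f (t + a) = f t) ∧ f 0 = 0 ∧ g 0 = 1 := by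
  obtain ⟨E, hE, hsol, -⟩ := hθ.exists_amplitude hQ
  have hr₀ := (hsol.smul_add_smul (hsol.reflect hp₀) 1 1).eq_zero hQ (t₀ := 0)
    (by simp [h0]) (by simp)
  have hra := (hsol.smul_add_smul (hsol.reflect hpa) 1 1).eq_zero hQ (t₀ := a / 2)
    (by simp [sub_half, hc]) (by simp [sub_half])
  have hne := (hE 0).ne'
  refine ⟨_, _, hsol.smul_add_smul hsol (1 / E 0) 0, fun t => ?_, by simp [h0], by simp [h0, hne]⟩
  have h1 := hr₀ t
  have h2 := hra (t + a)
  rw [show a - (t + a) = 0 - t by ring] at h2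
  beta_reduce at h1 h2 ⊢
  linear_combination (1 / E 0) * (h2 - h1)

lemma neumann_of_periodic (hQ : Continuous Q) (hp₀ : ∀ t, Q (0 - t) = Q t) {θ f g : ℝ → ℝ}
    (hθ : IsPruferPhase Q θ) (h0 : θ 0 = π / 2) (hsol : IsHillSolution Q f g)
    (hper : ∀ t, g (t + a) = g t) (hf : f 0 ≠ 0) : cos (θ (a / 2)) = 0 := by
  obtain ⟨E, hE, -, hu⟩ := hθ.exists_amplitude hQ
  obtain ⟨C, hC⟩ := hu _ _ (hsol.smul_add_smul (hsol.reflect hp₀) 1 1) 0 (by simp [h0])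
  have h1 := (hC 0).1
  have h2 := (hC (a / 2)).2
  have h3 := hper (0 - a / 2)
  rw [show 0 - a / 2 + a = a / 2 by ring] at h3
  simp only [h3, h0, sub_zero, sin_pi_div_two] at h1 h2
  have hC0 : C ≠ 0 := by
    rintro rfl
    exact hf (by linarith)
  have h4 : C * (E (a / 2) * cos (θ (a / 2))) = 0 := by linarith
  simpa [hC0, (hE _).ne'] using h4

lemma dirichlet_of_periodic (hQ : Continuous Q) (hp₀ : ∀ t, Q (0 - t) = Q t) {θ f g : ℝ → ℝ}
    (hθ : IsPruferPhase Q θ) (h0 : θ 0 = 0) (hsol : IsHillSolution Q f g)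
    (hper : ∀ t, f (t + a) = f t) (hg : g 0 ≠ 0) : sin (θ (a / 2)) = 0 := by
  obtain ⟨E, hE, -, hu⟩ := hθ.exists_amplitude hQ
  obtain ⟨C, hC⟩ := hu _ _ (hsol.smul_add_smul (hsol.reflect hp₀) 1 (-1)) 0 (by simp [h0])
  have h1 := (hC 0).2
  have h2 := (hC (a / 2)).1
  have h3 := hper (0 - a / 2)
  rw [show 0 - a / 2 + a = a / 2 by ring] at h3
  simp only [h3, h0, sub_zero, cos_zero] at h1 h2
  have hC0 : C ≠ 0 := by
    rintro rfl
    exact hg (by linarith)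
  have h4 : C * (E (a / 2) * sin (θ (a / 2))) = 0 := by linarith
  simpa [hC0, (hE _).ne'] using h4

end Symmetric

/-- The set of smooth `a`-periodic solutions of `u'' + (V + μ) u = 0`. -/
def periodicSolutions (a : ℝ) (V : ℝ → ℝ) (μ : ℝ) : Set (ℝ → ℝ) :=
  {u | ContDiff ℝ (⊤ : ℕ∞) u ∧
    (∀ x : ℝ, deriv (deriv u) x + (V x + μ) * u x = 0) ∧ ∀ x : ℝ, u (x + a) = u x}

lemma isHillSolution_of_mem {a μ : ℝ} {V u : ℝ → ℝ} (hu : u ∈ periodicSolutions a V μ) :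
    IsHillSolution (fun t => V t + μ) u (deriv u) := fun t => by
  have h1 := contDiff_infty_iff_deriv.1 hu.1
  refine ⟨(h1.1 t).hasDerivAt, ?_⟩
  exact ((contDiff_infty_iff_deriv.1 h1.2).1 t).hasDerivAt.congr_deriv
    (by linear_combination hu.2.1 t)

lemma deriv_periodic_of_mem {a μ : ℝ} {V u : ℝ → ℝ} (hu : u ∈ periodicSolutions a V μ) (t : ℝ) :
    deriv u (t + a) = deriv u t := by
  rw [← deriv_comp_add_const]
  congr 1
  exact funext hu.2.2

lemma IsHillSolution.contDiff {Q f g : ℝ → ℝ} (hQ : ContDiff ℝ (⊤ : ℕ∞) Q)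
    (h : IsHillSolution Q f g) : ContDiff ℝ (⊤ : ℕ∞) f := by
  have df : deriv f = g := funext fun t => (h t).1.deriv
  have dg : deriv g = fun t => -(Q t * f t) := funext fun t => (h t).2.deriv
  have key : ∀ n : ℕ, ContDiff ℝ n f ∧ ContDiff ℝ n g := by
    intro n
    induction n with
    | zero =>
      exact ⟨contDiff_zero.2 (continuous_iff_continuousAt.2 fun t => (h t).1.continuousAt),
        contDiff_zero.2 (continuous_iff_continuousAt.2 fun t => (h t).2.continuousAt)⟩
    | succ n ih =>
      push_cast
      refine ⟨contDiff_succ_iff_deriv.2 ⟨fun t => (h t).1.differentiableAt, by simp, ?_⟩,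
        contDiff_succ_iff_deriv.2 ⟨fun t => (h t).2.differentiableAt, by simp, ?_⟩⟩
      · rw [df]; exact ih.2
      · rw [dg]
        exact ((hQ.of_le (by exact_mod_cast le_top)).mul ih.1).neg
  exact contDiff_infty.2 fun n => (key n).1

lemma IsHillSolution.mem_periodicSolutions {a μ : ℝ} {V f g : ℝ → ℝ}
    (hV : ContDiff ℝ (⊤ : ℕ∞) V) (h : IsHillSolution (fun t => V t + μ) f g)
    (hper : ∀ t, f (t + a) = f t) : f ∈ periodicSolutions a V μ := by
  refine ⟨h.contDiff (hV.add contDiff_const), fun t => ?_, hper⟩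
  have df : deriv f = g := funext fun t => (h t).1.deriv
  rw [df, (h t).2.deriv]
  ring

lemma dimE0_eq {a : ℝ} {V : ℝ → ℝ} (hV : ContDiff ℝ (⊤ : ℕ∞) V) (hp₀ : ∀ t, V (0 - t) = V t)
    (hpa : ∀ t, V (a - t) = V t) {μ : ℝ} {η δ : ℝ → ℝ}
    (hη : IsPruferPhase (fun t => V t + μ) η) (hη0 : η 0 = π / 2)
    (hδ : IsPruferPhase (fun t => V t + μ) δ) (hδ0 : δ 0 = 0) [Decidable (cos (η (a / 2)) = 0)]
    [Decidable (sin (δ (a / 2)) = 0)] :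
    dimE0 a V μ = (if cos (η (a / 2)) = 0 then 1 else 0) + if sin (δ (a / 2)) = 0 then 1 else 0 := by
  have hQ : Continuous fun t => V t + μ := hV.continuous.add continuous_const
  have hQ₀ : ∀ t, V (0 - t) + μ = V t + μ := fun t => by rw [hp₀]
  have hQa : ∀ t, V (a - t) + μ = V t + μ := fun t => by rw [hpa]
  have hN : ∀ u ∈ periodicSolutions a V μ, cos (η (a / 2)) ≠ 0 → u 0 = 0 := fun u hu hc => by
    by_contra h
    exact hc (neumann_of_periodic hQ hQ₀ hη hη0 (isHillSolution_of_mem hu)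
      (deriv_periodic_of_mem hu) h)
  have hD : ∀ u ∈ periodicSolutions a V μ, sin (δ (a / 2)) ≠ 0 → deriv u 0 = 0 := fun u hu hc => by
    by_contra h
    exact hc (dirichlet_of_periodic hQ hQ₀ hδ hδ0 (isHillSolution_of_mem hu) hu.2.2 h)
  have hspan : ∀ f g, ∀ f₁ g₁ f₂ g₂, IsHillSolution (fun t => V t + μ) f g →
      IsHillSolution (fun t => V t + μ) f₁ g₁ → IsHillSolution (fun t => V t + μ) f₂ g₂ →
      ∀ α β : ℝ, f 0 = α * f₁ 0 + β * f₂ 0 → g 0 = α * g₁ 0 + β * g₂ 0 →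
      f = α • f₁ + β • f₂ := by
    intro f g f₁ g₁ f₂ g₂ h h₁ h₂ α β e₁ e₂
    have := (h.smul_add_smul (h₁.smul_add_smul h₂ α β) 1 (-1)).eq_zero hQ (t₀ := 0)
      (by rw [e₁]; ring) (by rw [e₂]; ring)
    funext t
    simp only [Pi.add_apply, Pi.smul_apply, smul_eq_mul]
    linear_combination this t
  have hzero : IsHillSolution (fun t => V t + μ) 0 0 := fun t => by simp
  change Module.finrank ℝ ↥(Submodule.span ℝ (periodicSolutions a V μ)) = _
  by_cases cN : cos (η (a / 2)) = 0 <;> by_cases cD : sin (δ (a / 2)) = 0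
  · obtain ⟨f₁, g₁, s₁, p₁, e₁, d₁⟩ := exists_periodic_of_neumann hQ hQ₀ hQa hη hη0 cN
    obtain ⟨f₂, g₂, s₂, p₂, e₂, d₂⟩ := exists_periodic_of_dirichlet hQ hQ₀ hQa hδ hδ0 cD
    have hli : LinearIndependent ℝ ![f₁, f₂] := by
      refine LinearIndependent.pair_iff.2 fun α β h => ?_
      have hα : α = 0 := by simpa [e₁, e₂] using congrFun h 0
      subst hα
      refine ⟨rfl, ?_⟩
      have h' : (fun t => β * f₂ t) = fun _ => 0 := funext fun t => by simpa using congrFun h t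
      have h1 := ((s₂ 0).1.const_mul β).unique (by rw [h']; exact hasDerivAt_const _ _)
      simpa [d₂] using h1
    have : Submodule.span ℝ (periodicSolutions a V μ) = Submodule.span ℝ (range ![f₁, f₂]) := by
      refine le_antisymm (Submodule.span_le.2 fun u hu => ?_) (Submodule.span_mono ?_)
      · rw [hspan u _ f₁ g₁ f₂ g₂ (isHillSolution_of_mem hu) s₁ s₂ (u 0) (deriv u 0)
          (by simp [e₁, e₂]) (by simp [d₁, d₂])]
        exact add_mem (Submodule.smul_mem _ _ (Submodule.subset_span ⟨0, rfl⟩))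
          (Submodule.smul_mem _ _ (Submodule.subset_span ⟨1, rfl⟩))
      · rintro _ ⟨i, rfl⟩
        fin_cases i
        · exact s₁.mem_periodicSolutions hV p₁
        · exact s₂.mem_periodicSolutions hV p₂
    rw [this, finrank_span_eq_card hli]
    simp [cN, cD]
  · obtain ⟨f₁, g₁, s₁, p₁, e₁, d₁⟩ := exists_periodic_of_neumann hQ hQ₀ hQa hη hη0 cN
    have hne : f₁ ≠ 0 := fun h => by simp [h] at e₁
    have : Submodule.span ℝ (periodicSolutions a V μ) = Submodule.span ℝ {f₁} := by
      refine le_antisymm (Submodule.span_le.2 fun u hu => ?_) (Submodule.span_mono ?_)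
      · rw [hspan u _ f₁ g₁ 0 0 (isHillSolution_of_mem hu) s₁ hzero (u 0) 0
          (by simp [e₁]) (by simp [d₁, hD u hu cD])]
        exact add_mem (Submodule.smul_mem _ _ (Submodule.subset_span rfl)) (by simp)
      · rintro _ rfl
        exact s₁.mem_periodicSolutions hV p₁
    rw [this, finrank_span_singleton hne]
    simp [cN, cD]
  · obtain ⟨f₁, g₁, s₁, p₁, e₁, d₁⟩ := exists_periodic_of_dirichlet hQ hQ₀ hQa hδ hδ0 cD
    have hne : f₁ ≠ 0 := fun h => by
      have h1 := (s₁ 0).1.unique (by rw [h]; exact hasDerivAt_const _ _)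
      simp [d₁] at h1
    have : Submodule.span ℝ (periodicSolutions a V μ) = Submodule.span ℝ {f₁} := by
      refine le_antisymm (Submodule.span_le.2 fun u hu => ?_) (Submodule.span_mono ?_)
      · rw [hspan u _ f₁ g₁ 0 0 (isHillSolution_of_mem hu) s₁ hzero (deriv u 0) 0
          (by simp [e₁, hN u hu cN]) (by simp [d₁])]
        exact add_mem (Submodule.smul_mem _ _ (Submodule.subset_span rfl)) (by simp)
      · rintro _ rfl
        exact s₁.mem_periodicSolutions hV p₁
    rw [this, finrank_span_singleton hne]
    simp [cN, cD]
  · have : Submodule.span ℝ (periodicSolutions a V μ) = ⊥ := by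
      refine Submodule.span_eq_bot.2 fun u hu => ?_
      rw [hspan u _ 0 0 0 0 (isHillSolution_of_mem hu) hzero hzero 0 0
        (by simp [hN u hu cN]) (by simp [hD u hu cD])]
      simp
    rw [this, finrank_bot]
    simp [cN, cD]

/-- A phase that advances by `2πn` over `[0, a)` passes `2n` multiples of `π`. -/
lemma IsPruferPhase.ncard_zeros {Q θ : ℝ → ℝ} (hQ : Continuous Q) (hθ : IsPruferPhase Q θ)
    {a : ℝ} (ha : 0 < a) {n : ℕ} (hn : θ a = θ 0 + 2 * n * π) :
    {x : ℝ | x ∈ Ico 0 a ∧ sin (θ x) = 0}.ncard = 2 * n := by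
  have hπ := pi_pos
  set K : ℤ := ⌈θ 0 / π⌉
  have hmem : ∀ m : ℤ, m ∈ Ico K (K + 2 * n) ↔ θ 0 ≤ m * π ∧ m * π < θ a := by
    intro m
    have h2 : m < K + 2 * n ↔ m * π < θ a := by
      rw [hn, ← sub_lt_iff_lt_add, Int.lt_ceil, lt_div_iff₀ hπ]
      push_cast
      constructor <;> intro h <;> linarith
    rw [mem_Ico, h2, Int.ceil_le, div_le_iff₀ hπ]
  have hex : ∀ m ∈ Ico K (K + 2 * n), ∃ x ∈ Ico 0 a, θ x = m * π := fun m hm =>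
    intermediate_value_Ico ha.le hθ.continuous.continuousOn ((hmem m).1 hm)
  choose! X hX hθX using hex
  have himage : {x : ℝ | x ∈ Ico 0 a ∧ sin (θ x) = 0} = X '' Ico K (K + 2 * n) := by
    ext x
    constructor
    · rintro ⟨hx, h0⟩
      obtain ⟨m, hm⟩ := sin_eq_zero_iff.1 h0
      have hmK : m ∈ Ico K (K + 2 * n) := by
        refine (hmem m).2 ⟨?_, hθ.int_mul_pi_lt hQ hx.2 m hm.le⟩
        by_contra! h
        rcases hx.1.eq_or_lt with rfl | hx0
        · exact h.ne hm
        · exact (hθ.int_mul_pi_lt hQ hx0 m h.le).ne hm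
      refine ⟨m, hmK, ?_⟩
      rcases lt_trichotomy (X m) x with h | h | h
      · exact absurd hm (hθ.int_mul_pi_lt hQ h m (hθX m hmK).ge).ne
      · exact h
      · exact absurd (hθX m hmK) (hθ.int_mul_pi_lt hQ h m hm.le).ne'
    · rintro ⟨m, hm, rfl⟩
      exact ⟨hX m hm, by rw [hθX m hm, sin_int_mul_pi]⟩
  have hinj : InjOn X (Ico K (K + 2 * n)) := fun m hm m' hm' h => by
    have h1 := hθX m hm
    rw [h, hθX m' hm'] at h1
    exact_mod_cast (mul_right_cancel₀ hπ.ne' h1).symm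
  rw [himage, hinj.ncard_image, ← Finset.coe_Ico, ncard_coe_finset, Int.card_Ico]
  simp only [add_sub_cancel_left]
  norm_cast

/-- Two phases of the same equation advance alike: if one advances by `2πn` and the other by a
multiple of `π`, then the advances agree. -/
lemma IsPruferPhase.advance_eq {Q φ ψ : ℝ → ℝ} (hQ : Continuous Q) (hφ : IsPruferPhase Q φ)
    (hψ : IsPruferPhase Q ψ) {a : ℝ} (ha : 0 < a) {n : ℕ} (hn : ψ a = ψ 0 + 2 * n * π)
    (hs : sin (φ a - φ 0) = 0) : φ a = φ 0 + 2 * n * π := by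
  have hπ := pi_pos
  set m : ℤ := ⌊(φ 0 - ψ 0) / π⌋
  have h1 : ψ 0 + m * π ≤ φ 0 := by
    have := (le_div_iff₀ hπ).1 (Int.floor_le ((φ 0 - ψ 0) / π))
    linarith
  have h2 : φ 0 < ψ 0 + (m + 1 : ℤ) * π := by
    have := (div_lt_iff₀ hπ).1 (Int.lt_floor_add_one ((φ 0 - ψ 0) / π))
    push_cast
    linarith
  have h2' := hφ.lt_of_lt hQ (hψ.add_int_mul_pi (m + 1)) ha.le h2
  rcases h1.eq_or_lt with h1 | h1
  · have := congrFun ((hψ.add_int_mul_pi m).eq_of_eq hQ hφ h1) a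
    beta_reduce at this
    linarith
  · have h1' := (hψ.add_int_mul_pi m).lt_of_lt hQ hφ ha.le h1
    obtain ⟨i, hi⟩ := sin_eq_zero_iff.1 hs
    push_cast at h2 h2'
    have h3 : (i : ℝ) < ((2 * n + 1 : ℤ) : ℝ) :=
      lt_of_mul_lt_mul_right (by push_cast; linarith) hπ.le
    have h4 : ((2 * n - 1 : ℤ) : ℝ) < i :=
      lt_of_mul_lt_mul_right (by push_cast; linarith) hπ.le
    have h5 : i = 2 * n := by
      have := Int.cast_lt.1 h3
      have := Int.cast_lt.1 h4
      omega
    rw [h5] at hi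
    push_cast at hi
    linarith

/-- Number of parameters `μ < lam` at which a strictly increasing function vanishing at `-∞` takes
one of the values `δ + iπ`. -/
lemma card_levels {g : ℝ → ℝ} (hg : StrictMono g) (hc : Continuous g)
    (hlim : Tendsto g atBot (𝓝 0)) {δ lam : ℝ} (hδ : 0 < δ) {j : ℕ} (hle : g lam ≤ δ + j * π)
    (hlt : ∀ i < j, δ + i * π < g lam) {S : Finset ℝ}
    (hS : ∀ μ, μ ∈ S ↔ μ < lam ∧ ∃ i : ℕ, g μ = δ + i * π) : S.card = j := by
  have hπ := pi_pos
  obtain ⟨b, hb, hbl⟩ := ((hlim.eventually (gt_mem_nhds hδ)).and (Iio_mem_atBot lam)).exists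
  have hex : ∀ i < j, ∃ μ, g μ = δ + i * π := fun i hi => by
    obtain ⟨μ, -, h⟩ := intermediate_value_Icc (mem_Iio.1 hbl).le hc.continuousOn
      ⟨hb.le.trans (le_add_of_nonneg_right (by positivity)), (hlt i hi).le⟩
    exact ⟨μ, h⟩
  choose! X hX using hex
  have hSX : S = (Finset.range j).image X := by
    ext μ
    rw [hS, Finset.mem_image]
    constructor
    · rintro ⟨hμ, i, hi⟩
      have hij : i < j := by
        have h1 := (hg hμ).trans_le hle
        rw [hi] at h1
        exact_mod_cast lt_of_mul_lt_mul_right (by linarith : (i : ℝ) * π < j * π) hπ.le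
      exact ⟨i, Finset.mem_range.2 hij, hg.injective ((hX i hij).trans hi.symm)⟩
    · rintro ⟨i, hi, rfl⟩
      have hi := Finset.mem_range.1 hi
      exact ⟨hg.lt_iff_lt.1 ((hX i hi).trans_lt (hlt i hi)), i, hX i hi⟩
  rw [hSX, Finset.card_image_of_injOn, Finset.card_range]
  intro i hi i' hi' h
  have h1 := hX i (by simpa using hi)
  rw [h, hX i' (by simpa using hi')] at h1
  exact_mod_cast (mul_right_cancel₀ hπ.ne' (add_left_cancel h1)).symm

/-- Every vector of the plane has a polar angle. -/
lemma exists_phase_angle (x y : ℝ) : ∃ φ : ℝ, x * cos φ = y * sin φ := by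
  refine ⟨Complex.arg ⟨y, x⟩, ?_⟩
  have h1 := Complex.norm_mul_cos_arg ⟨y, x⟩
  have h2 := Complex.norm_mul_sin_arg ⟨y, x⟩
  simp only at h1 h2
  linear_combination cos (Complex.arg ⟨y, x⟩) * (-h2) + sin (Complex.arg ⟨y, x⟩) * h1

/-- If some phase advances by `2πn` over a period, every periodic solution has `2n` zeros. -/
lemma ncard_zeros_of_advance {a μ : ℝ} (ha : 0 < a) {V f : ℝ → ℝ} (hV : Continuous V)
    (hf : f ∈ periodicSolutions a V μ) (hne : f ≠ 0) {ψ : ℝ → ℝ}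
    (hψ : IsPruferPhase (fun t => V t + μ) ψ) {n : ℕ} (hn : ψ a = ψ 0 + 2 * n * π) :
    {x : ℝ | x ∈ Ico 0 a ∧ f x = 0}.ncard = 2 * n := by
  have hQ : Continuous fun t => V t + μ := by fun_prop
  obtain ⟨φ₀, hφ₀⟩ := exists_phase_angle (f 0) (deriv f 0)
  obtain ⟨φ, hφ, rfl⟩ := exists_pruferPhase hQ φ₀
  obtain ⟨E, hE, -, hu⟩ := hφ.exists_amplitude hQ
  obtain ⟨C, hC⟩ := hu f (deriv f) (isHillSolution_of_mem hf) 0 hφ₀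
  have hC0 : C ≠ 0 := by
    rintro rfl
    exact hne (funext fun t => by simpa using (hC t).1)
  have hs : sin (φ a - φ 0) = 0 := by
    have e₁ : f a = f 0 := by simpa using hf.2.2 0
    have e₂ : deriv f a = deriv f 0 := by simpa using deriv_periodic_of_mem hf 0
    have h : C * E a * (C * E 0) * sin (φ a - φ 0) = 0 := by
      rw [sin_sub]
      linear_combination (-(C * E 0 * cos (φ 0))) * (hC a).1 + C * E 0 * sin (φ 0) * (hC a).2
        + C * E 0 * cos (φ 0) * e₁ - C * E 0 * sin (φ 0) * e₂
        + C * E 0 * cos (φ 0) * (hC 0).1 - C * E 0 * sin (φ 0) * (hC 0).2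
    simpa [hC0, (hE _).ne'] using h
  rw [← hφ.ncard_zeros hQ ha (hφ.advance_eq hQ hψ ha hn hs)]
  congr 1
  ext x
  simp [(hC x).1, hC0, (hE x).ne']

/-- If `V` is real-analytic, `a`-periodic and even, `lam` is a periodic eigenvalue of
`L = -d²/dx² - V`, and `k = Σ_{μ < lam} dim E₀(μ)` is finite (so that `lam` occupies
position `j = k + 1` in the spectrum counted with multiplicity), then every periodic
eigenfunction for `lam` has exactly `2⌊(k+1)/2⌋` zeros in `[0,a)`, i.e. `j` nodes if
`j` is even and `j - 1` nodes if `j` is odd. -/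
theorem periodic_eigenfunction_node_count (a : ℝ) (ha : 0 < a) (V : ℝ → ℝ)
    (hV : AnalyticOnNhd ℝ V Set.univ) (hper : ∀ x : ℝ, V (x + a) = V x)
    (heven : ∀ x : ℝ, V (-x) = V x) (lam : ℝ)
    (hlam : ∃ f, IsPeriodicEigenfunction a V lam f) (k : ℕ)
    (hfin : {μ : ℝ | μ < lam ∧ ∃ f, IsPeriodicEigenfunction a V μ f}.Finite)
    (hk : k = ∑ μ ∈ hfin.toFinset, dimE0 a V μ) :
    ∀ f, IsPeriodicEigenfunction a V lam f →
      {x : ℝ | x ∈ Set.Ico 0 a ∧ f x = 0}.ncard = 2 * ((k + 1) / 2) := by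
  classical
  rintro f ⟨hfs, hf0, hfe, hfp⟩
  have hf : f ∈ periodicSolutions a V lam := ⟨hfs, hfe, hfp⟩
  have hπ := pi_pos
  have hc : 0 < a / 2 := by positivity
  have hVs : ContDiff ℝ (⊤ : ℕ∞) V :=
    contDiff_iff_contDiffAt.2 fun x => (hV x (mem_univ x)).contDiffAt
  have hVc : Continuous V := hVs.continuous
  have hp₀ : ∀ t, V (0 - t) = V t := fun t => by rw [zero_sub, heven]
  have hpa : ∀ t, V (a - t) = V t := fun t => by rw [sub_eq_neg_add, hper, heven]
  have hQ : ∀ μ, Continuous fun t => V t + μ := fun μ => by fun_prop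
  have hQ₀ : ∀ μ t, V (0 - t) + μ = V t + μ := fun μ t => by rw [hp₀]
  have hQa : ∀ μ t, V (a - t) + μ = V t + μ := fun μ t => by rw [hpa]
  choose η hη hη0 using fun μ => exists_pruferPhase (hQ μ) (π / 2)
  choose δ hδ hδ0 using fun μ => exists_pruferPhase (hQ μ) 0
  have hηpos : ∀ μ, 0 < η μ (a / 2) := fun μ => by
    simpa using (hη μ).int_mul_pi_lt (hQ μ) hc 0 (by simp [hη0, pi_div_two_pos.le])
  have hδpos : ∀ μ, 0 < δ μ (a / 2) := fun μ => by
    simpa using (hδ μ).int_mul_pi_lt (hQ μ) hc 0 (by simp [hδ0])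
  have hNiff : ∀ μ, cos (η μ (a / 2)) = 0 ↔ ∃ i : ℕ, η μ (a / 2) = π / 2 + i * π := fun μ => by
    rw [cos_eq_zero_iff]
    constructor
    · rintro ⟨i, hi⟩
      have h1 := hηpos μ
      rw [hi] at h1
      have h2 : (0 : ℝ) < ((2 * i + 1 : ℤ) : ℝ) := by
        push_cast
        by_contra! h
        nlinarith
      have h3 := Int.cast_pos.1 h2
      lift i to ℕ using by omega
      exact ⟨i, by rw [hi]; push_cast; ring⟩
    · rintro ⟨i, hi⟩
      exact ⟨i, by rw [hi]; push_cast; ring⟩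
  have hDiff : ∀ μ, sin (δ μ (a / 2)) = 0 ↔ ∃ i : ℕ, δ μ (a / 2) = π + i * π := fun μ => by
    rw [sin_eq_zero_iff]
    constructor
    · rintro ⟨i, hi⟩
      have h1 := hδpos μ
      rw [← hi] at h1
      have h2 : (0 : ℝ) < (i : ℝ) := pos_of_mul_pos_left h1 hπ.le
      have h3 := Int.cast_pos.1 h2
      obtain ⟨m, hm⟩ := Int.eq_ofNat_of_zero_le (sub_nonneg.2 (Int.add_one_le_iff.2 h3))
      obtain rfl : i = m + 1 := by omega
      exact ⟨m, by rw [← hi]; push_cast; ring⟩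
    · rintro ⟨i, hi⟩
      exact ⟨i + 1, by rw [hi]; push_cast; ring⟩
  have hcard : ∀ jN jD : ℕ, η lam (a / 2) ≤ π / 2 + jN * π →
      (∀ i < jN, π / 2 + i * π < η lam (a / 2)) →
      δ lam (a / 2) ≤ π + jD * π → (∀ i < jD, π + i * π < δ lam (a / 2)) → k = jN + jD := by
    intro jN jD hN₁ hN₂ hD₁ hD₂
    rw [hk, Finset.sum_congr rfl fun μ _ =>
      dimE0_eq hVs hp₀ hpa (hη μ) (hη0 μ) (hδ μ) (hδ0 μ), Finset.sum_add_distrib,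
      ← Finset.card_filter, ← Finset.card_filter]
    congr 1
    · refine card_levels (g := fun μ => η μ (a / 2))
        (fun μ ν h => (hη μ).lt_of_potential_lt hVc h (hη ν) hc ((hη0 μ).trans (hη0 ν).symm))
        (continuous_pruferPhase_param hVc hη hη0 hc.le)
        (tendsto_pruferPhase_param_atBot hVc hη hη0 (by positivity) le_rfl hc)
        (by positivity) hN₁ hN₂ fun μ => ?_
      rw [Finset.mem_filter, Finite.mem_toFinset, ← hNiff]
      refine ⟨fun h => ⟨h.1.1, h.2⟩, fun h => ⟨⟨h.1, ?_⟩, h.2⟩⟩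
      obtain ⟨u, v, hu, hup, hu0, -⟩ :=
        exists_periodic_of_neumann (hQ μ) (hQ₀ μ) (hQa μ) (hη μ) (hη0 μ) h.2
      obtain ⟨h₁, h₂, h₃⟩ := hu.mem_periodicSolutions hVs hup
      exact ⟨u, h₁, fun h => by simp [h] at hu0, h₂, h₃⟩
    · refine card_levels (g := fun μ => δ μ (a / 2))
        (fun μ ν h => (hδ μ).lt_of_potential_lt hVc h (hδ ν) hc ((hδ0 μ).trans (hδ0 ν).symm))
        (continuous_pruferPhase_param hVc hδ hδ0 hc.le)
        (tendsto_pruferPhase_param_atBot hVc hδ hδ0 le_rfl (by positivity) hc)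
        hπ hD₁ hD₂ fun μ => ?_
      rw [Finset.mem_filter, Finite.mem_toFinset, ← hDiff]
      refine ⟨fun h => ⟨h.1.1, h.2⟩, fun h => ⟨⟨h.1, ?_⟩, h.2⟩⟩
      obtain ⟨u, v, hu, hup, -, hv0⟩ :=
        exists_periodic_of_dirichlet (hQ μ) (hQ₀ μ) (hQa μ) (hδ μ) (hδ0 μ) h.2
      obtain ⟨h₁, h₂, h₃⟩ := hu.mem_periodicSolutions hVs hup
      refine ⟨u, h₁, fun h => ?_, h₂, h₃⟩
      have h0 := (hu 0).1.unique (by rw [h]; exact hasDerivAt_const _ _)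
      simp [hv0] at h0
  have hlt₁ : δ lam (a / 2) < η lam (a / 2) :=
    (hδ lam).lt_of_lt (hQ lam) (hη lam) hc.le (by rw [hδ0, hη0]; positivity)
  have hlt₂ : η lam (a / 2) < δ lam (a / 2) + π := by
    have := (hη lam).lt_of_lt (hQ lam) ((hδ lam).add_int_mul_pi 1) hc.le
      (by rw [hδ0, hη0]; simp [hπ])
    simpa using this
  have hmul : ∀ {i j : ℕ}, i < j → (i : ℝ) * π + π ≤ j * π := fun {i j} h => by
    have : (i : ℝ) + 1 ≤ j := by exact_mod_cast h
    nlinarith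
  have hcases : (∃ n : ℕ, η lam (a / 2) = π / 2 + n * π) ∨ ∃ n : ℕ, δ lam (a / 2) = π + n * π := by
    by_cases h0 : f 0 = 0
    · refine Or.inr ((hDiff lam).1 (dirichlet_of_periodic (hQ lam) (hQ₀ lam) (hδ lam) (hδ0 lam)
        (isHillSolution_of_mem hf) hfp fun h1 => hf0 (funext ?_)))
      exact (isHillSolution_of_mem hf).eq_zero (hQ lam) h0 h1
    · exact Or.inl ((hNiff lam).1 (neumann_of_periodic (hQ lam) (hQ₀ lam) (hη lam) (hη0 lam)
        (isHillSolution_of_mem hf) (deriv_periodic_of_mem hf) h0))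
  rcases hcases with ⟨n, hn⟩ | ⟨n, hn⟩
  · have hadv : η lam a = η lam 0 + 2 * n * π := by
      have := congrFun ((hη lam).eq_of_eq (hQ lam) ((hη lam).reflect (hQa lam) (2 * n + 1))
        (t₀ := a / 2) (by rw [sub_half, hn]; push_cast; ring)) a
      rw [this, sub_self, hη0]
      push_cast
      ring
    rw [ncard_zeros_of_advance ha hVc hf hf0 (hη lam) hadv]
    have hN₂ : ∀ i < n, π / 2 + i * π < η lam (a / 2) := fun i hi => by
      have := hmul hi
      linarith
    by_cases hD : n * π < δ lam (a / 2)
    · have := hcard n n hn.le hN₂ (by linarith) fun i hi => by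
        have := hmul hi
        linarith
      omega
    · push Not at hD
      obtain _ | m := n
      · simp only [Nat.cast_zero, zero_mul] at hD
        exact absurd (hδpos lam) hD.not_gt
      · push_cast at hD hn
        have := hcard (m + 1) m (by push_cast; linarith) hN₂ (by linarith) fun i hi => by
          have := hmul hi
          linarith
        omega
  · have hadv : δ lam a = δ lam 0 + 2 * (n + 1 : ℕ) * π := by
      have := congrFun ((hδ lam).eq_of_eq (hQ lam) ((hδ lam).reflect (hQa lam) (2 * (n + 1)))
        (t₀ := a / 2) (by rw [sub_half, hn]; push_cast; ring)) a
      rw [this, sub_self, hδ0]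
      push_cast
      ring
    rw [ncard_zeros_of_advance ha hVc hf hf0 (hδ lam) hadv]
    have hD₂ : ∀ i < n, π + i * π < δ lam (a / 2) := fun i hi => by
      have := hmul hi
      linarith
    by_cases hN : π / 2 + (n + 1) * π < η lam (a / 2)
    · have := hcard (n + 2) n (by push_cast; linarith) (fun i hi => by
        have := hmul hi
        push_cast at this
        linarith) hn.le hD₂
      omega
    · have := hcard (n + 1) n (by push_cast; linarith) (fun i hi => by
        have := hmul hi
        push_cast at this
        linarith) hn.le hD₂
      omega
end

section
/- Let a > 0 and let V : ℝ → ℝ be real-analytic, a-periodic and even (V(−x) = V(x) for all x). Let λ < μ be real numbers and let f, g be periodic eigenfunctions of L = −d²/dx² − V for λ and μ respectively, each satisfying one of the two initial conditions f(0) = 0 or f'(0) = 0 (and likewise for g). If f and g satisfy different initial conditions (one vanishes at 0, the other has vanishing derivative at 0), then the number of zeros of g in [0,a) is at least the number of zeros of f in [0,a). -/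
open Set Filter Topology

/-- A solution of `f'' = -q f` with bounded `q` and vanishing Cauchy data is zero. -/
theorem eq_zero_of_second_order_linear {f f' q : ℝ → ℝ} {C c : ℝ}
    (hf : ∀ x, HasDerivAt f (f' x) x) (hf' : ∀ x, HasDerivAt f' (-q x * f x) x)
    (hq : ∀ x, |q x| ≤ C) (h0 : f c = 0) (h1 : f' c = 0) : f = 0 := by
  have hC : 0 ≤ C := (abs_nonneg _).trans (hq c)
  have hlip : ∀ t, LipschitzOnWith (Real.toNNReal (C + 1))
      ((fun (t : ℝ) (p : ℝ × ℝ) => (p.2, -q t * p.1)) t) univ := by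
    intro t
    refine LipschitzOnWith.of_dist_le_mul fun p _ r _ => ?_
    rw [Real.coe_toNNReal _ (by linarith), Prod.dist_eq, Prod.dist_eq]
    simp only [Real.dist_eq]
    have h1 := le_max_left |p.1 - r.1| |p.2 - r.2|
    have h2 := le_max_right |p.1 - r.1| |p.2 - r.2|
    have h3 := abs_nonneg (p.1 - r.1)
    refine max_le ?_ ?_
    · nlinarith
    · rw [← mul_sub, abs_mul, abs_neg]
      have := mul_le_mul (hq t) h1 h3 hC
      nlinarith
  have key : (fun t => (f t, f' t)) = fun _ => ((0 : ℝ), (0 : ℝ)) := by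
    refine ODE_solution_unique_univ (t₀ := c) hlip
      (fun t => ⟨(hf t).prodMk (hf' t), mem_univ _⟩) (fun t => ⟨?_, mem_univ _⟩) ?_
    · simpa [← Prod.mk_zero_zero] using hasDerivAt_const t ((0 : ℝ), (0 : ℝ))
    · simp [h0, h1]
  funext t
  exact congrArg Prod.fst (congrFun key t)

/-- A nonzero solution of `f'' = -q f` with bounded `q` has finitely many zeros in a compact set. -/
theorem finite_zeros_of_second_order_linear {f f' q : ℝ → ℝ} {C : ℝ} {K : Set ℝ}
    (hf : ∀ x, HasDerivAt f (f' x) x) (hf' : ∀ x, HasDerivAt f' (-q x * f x) x)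
    (hq : ∀ x, |q x| ≤ C) (hne : f ≠ 0) (hK : IsCompact K) : {x | x ∈ K ∧ f x = 0}.Finite := by
  by_contra hinf
  obtain ⟨c, -, hc⟩ := Set.Infinite.exists_accPt_of_subset_isCompact hinf hK fun x hx => hx.1
  rw [accPt_iff_frequently_nhdsNE] at hc
  have hfreq : ∃ᶠ x in 𝓝[≠] c, f x = 0 := hc.mono fun x hx => hx.2
  have h1 : f' c = 0 := by
    by_contra h
    exact hfreq ((hf c).eventually_ne h)
  have h0 : f c = 0 := by
    have hcl : IsClosed {x | f x = 0} :=
      isClosed_eq (continuous_iff_continuousAt.2 fun x => (hf x).continuousAt) continuous_const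
    exact hcl.mem_of_frequently_of_tendsto hfreq (tendsto_id.mono_left nhdsWithin_le_nhds)
  exact hne (eq_zero_of_second_order_linear hf hf' hq h0 h1)

/-- A function that is nonnegative to the right of a zero has nonnegative derivative there. -/
theorem HasDerivAt.nonneg_of_nonneg_right {f : ℝ → ℝ} {d u v : ℝ} (hf : HasDerivAt f d u)
    (huv : u < v) (hu : f u = 0) (hpos : ∀ x ∈ Ioo u v, 0 ≤ f x) : 0 ≤ d := by
  have h := (hasDerivAt_iff_tendsto_slope.1 hf).mono_left (nhdsGT_le_nhdsNE u)
  refine ge_of_tendsto h ?_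
  filter_upwards [Ioo_mem_nhdsGT huv] with x hx
  rw [slope_def_field, hu, sub_zero]
  exact div_nonneg (hpos x hx) (by linarith [hx.1])

/-- A function that is nonnegative to the left of a zero has nonpositive derivative there. -/
theorem HasDerivAt.nonpos_of_nonneg_left {f : ℝ → ℝ} {d u v : ℝ} (hf : HasDerivAt f d v)
    (huv : u < v) (hv : f v = 0) (hpos : ∀ x ∈ Ioo u v, 0 ≤ f x) : d ≤ 0 := by
  have h := (hasDerivAt_iff_tendsto_slope.1 hf).mono_left (nhdsLT_le_nhdsNE v)
  refine le_of_tendsto h ?_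
  filter_upwards [Ioo_mem_nhdsLT huv] with x hx
  rw [slope_def_field, hv, sub_zero]
  exact div_nonpos_of_nonneg_of_nonpos (hpos x hx) (by linarith [hx.2])

/-- A continuous function without zeros on an open interval has constant sign there. -/
theorem forall_pos_or_forall_neg_of_ne_zero {f : ℝ → ℝ} {u v : ℝ} (hf : Continuous f)
    (hne : ∀ x ∈ Ioo u v, f x ≠ 0) :
    (∀ x ∈ Ioo u v, 0 < f x) ∨ ∀ x ∈ Ioo u v, 0 < -f x := by
  by_contra! h
  obtain ⟨⟨x, hx, hfx⟩, y, hy, hfy⟩ := h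
  obtain ⟨z, hz, hfz⟩ := isPreconnected_Ioo.intermediate_value hx hy hf.continuousOn
    (show (0 : ℝ) ∈ Icc (f x) (f y) from ⟨hfx, by linarith⟩)
  exact hne z hz hfz

/-- Solutions of `f'' = -p f` and `g'' = -q g` with `p < q` cannot both be positive between
consecutive zeros of `f`. -/
theorem sturm_comparison_pos {f f' g g' p q : ℝ → ℝ} {u v : ℝ}
    (hf : ∀ x, HasDerivAt f (f' x) x) (hf' : ∀ x, HasDerivAt f' (-p x * f x) x)
    (hg : ∀ x, HasDerivAt g (g' x) x) (hg' : ∀ x, HasDerivAt g' (-q x * g x) x)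
    (hpq : ∀ x, p x < q x) (huv : u < v) (hu : f u = 0) (hv : f v = 0)
    (hfpos : ∀ x ∈ Ioo u v, 0 < f x) (hgpos : ∀ x ∈ Ioo u v, 0 < g x) : False := by
  have hgc : Continuous g := continuous_iff_continuousAt.2 fun x => (hg x).continuousAt
  have hgcl : ∀ x ∈ Icc u v, 0 ≤ g x := by
    rw [← closure_Ioo huv.ne]
    exact closure_minimal (fun x hx => (hgpos x hx).le) (isClosed_le continuous_const hgc)
  have hW : ∀ x, HasDerivAt (fun x => f x * g' x - f' x * g x) ((p x - q x) * (f x * g x)) x := by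
    intro x
    convert! ((hf x).mul (hg' x)).sub ((hf' x).mul (hg x)) using 1
    ring
  have hanti : StrictAntiOn (fun x => f x * g' x - f' x * g x) (Icc u v) := by
    refine strictAntiOn_of_deriv_neg (convex_Icc u v)
      (fun x _ => (hW x).continuousAt.continuousWithinAt) fun x hx => ?_
    rw [interior_Icc] at hx
    rw [(hW x).deriv]
    exact mul_neg_of_neg_of_pos (sub_neg.2 (hpq x)) (mul_pos (hfpos x hx) (hgpos x hx))
  have hlt := hanti (left_mem_Icc.2 huv.le) (right_mem_Icc.2 huv.le) huv
  simp only [hu, hv, zero_mul, zero_sub, neg_lt_neg_iff] at hlt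
  have h1 := (hf u).nonneg_of_nonneg_right huv hu fun x hx => (hfpos x hx).le
  have h2 := (hf v).nonpos_of_nonneg_left huv hv fun x hx => (hfpos x hx).le
  have h3 := mul_nonneg h1 (hgcl u (left_mem_Icc.2 huv.le))
  have h4 := mul_nonpos_of_nonpos_of_nonneg h2 (hgcl v (right_mem_Icc.2 huv.le))
  linarith

/-- Sturm comparison: if `f'' = -p f` and `g'' = -q g` with `p < q`, then `g` vanishes between
consecutive zeros of `f`. -/
theorem sturm_comparison {f f' g g' p q : ℝ → ℝ} {u v : ℝ}
    (hf : ∀ x, HasDerivAt f (f' x) x) (hf' : ∀ x, HasDerivAt f' (-p x * f x) x)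
    (hg : ∀ x, HasDerivAt g (g' x) x) (hg' : ∀ x, HasDerivAt g' (-q x * g x) x)
    (hpq : ∀ x, p x < q x) (huv : u < v) (hu : f u = 0) (hv : f v = 0)
    (hne : ∀ x ∈ Ioo u v, f x ≠ 0) : ∃ x ∈ Ioo u v, g x = 0 := by
  by_contra! hgne
  have neg_solution : ∀ {h h' r : ℝ → ℝ}, (∀ x, HasDerivAt h' (-r x * h x) x) →
      ∀ x, HasDerivAt (fun y => -h' y) (-r x * -h x) x := by
    intro h h' r hh x
    convert! (hh x).neg using 1
    ring
  have hfc : Continuous f := continuous_iff_continuousAt.2 fun x => (hf x).continuousAt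
  have hgc : Continuous g := continuous_iff_continuousAt.2 fun x => (hg x).continuousAt
  have hu' : -f u = 0 := by rw [hu, neg_zero]
  have hv' : -f v = 0 := by rw [hv, neg_zero]
  rcases forall_pos_or_forall_neg_of_ne_zero hfc hne with hs | hs <;>
    rcases forall_pos_or_forall_neg_of_ne_zero hgc hgne with ht | ht
  · exact sturm_comparison_pos hf hf' hg hg' hpq huv hu hv hs ht
  · exact sturm_comparison_pos hf hf' (fun x => (hg x).neg) (neg_solution hg') hpq huv hu hv hs ht
  · exact sturm_comparison_pos (fun x => (hf x).neg) (neg_solution hf') hg hg' hpq huv hu' hv' hs ht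
  · exact sturm_comparison_pos (fun x => (hf x).neg) (neg_solution hf') (fun x => (hg x).neg)
      (neg_solution hg') hpq huv hu' hv' hs ht

/-- If `g` vanishes between consecutive zeros of `f`, both being `a`-periodic, then `g` has at
least as many zeros per period as `f`. -/
theorem ncard_zeros_le_of_interlacing {f g : ℝ → ℝ} {a : ℝ} (ha : 0 < a)
    (hfper : Function.Periodic f a) (hgper : Function.Periodic g a)
    (hffin : ∀ u v : ℝ, {x | x ∈ Icc u v ∧ f x = 0}.Finite)
    (hgfin : {x | x ∈ Ico 0 a ∧ g x = 0}.Finite)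
    (hinter : ∀ u v, u < v → f u = 0 → f v = 0 → (∀ x ∈ Ioo u v, f x ≠ 0) →
      ∃ x ∈ Ioo u v, g x = 0) :
    {x : ℝ | x ∈ Ico 0 a ∧ f x = 0}.ncard ≤ {x : ℝ | x ∈ Ico 0 a ∧ g x = 0}.ncard := by
  have hnext : ∀ z, f z = 0 → ∃ y, z < y ∧ g y = 0 ∧ ∀ x ∈ Ioc z y, f x ≠ 0 := by
    intro z hz
    have hfin : {x | x ∈ Ioc z (z + a) ∧ f x = 0}.Finite :=
      (hffin z (z + a)).subset fun x hx => ⟨Ioc_subset_Icc_self hx.1, hx.2⟩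
    have hza : z + a ∈ {x | x ∈ Ioc z (z + a) ∧ f x = 0} :=
      ⟨⟨by linarith, le_rfl⟩, by rw [hfper z, hz]⟩
    obtain ⟨w, ⟨hw, hfw⟩, hmin⟩ := exists_min_image _ id hfin ⟨_, hza⟩
    have hgap : ∀ x ∈ Ioo z w, f x ≠ 0 := fun x hx hfx =>
      (hmin x ⟨⟨hx.1, hx.2.le.trans hw.2⟩, hfx⟩).not_gt hx.2
    obtain ⟨y, hy, hgy⟩ := hinter z w hw.1 hz hfw hgap
    exact ⟨y, hy.1, hgy, fun x hx => hgap x ⟨hx.1, hx.2.trans_lt hy.2⟩⟩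
  choose! φ hlt hgφ hφ using hnext
  refine ncard_le_ncard_of_injOn (fun z => toIcoMod ha 0 (φ z)) (fun z hz => ?_) ?_ hgfin
  · refine ⟨toIcoMod_mem_Ico' ha _, ?_⟩
    rw [← self_sub_toIcoDiv_zsmul, hgper.sub_zsmul_eq]
    exact hgφ z hz.2
  · have hle : ∀ z w, f z = 0 → f w = 0 → ∀ n : ℤ, φ z = φ w + n • a → w + n • a ≤ z := by
      intro z w hz hw n h
      by_contra! hcon
      refine hφ z hz (w + n • a) ⟨hcon, ?_⟩ ?_
      · linarith [hlt w hw]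
      · rw [hfper.zsmul n w, hw]
    intro z hz w hw h
    simp only [← self_sub_toIcoDiv_zsmul] at h
    have h' : φ z = φ w + (toIcoDiv ha 0 (φ z) - toIcoDiv ha 0 (φ w)) • a := by
      rw [sub_zsmul]; linarith
    generalize toIcoDiv ha 0 (φ z) - toIcoDiv ha 0 (φ w) = n at h'
    have h1 := hle z w hz.2 hw.2 n h'
    have h2 := hle w z hw.2 hz.2 (-n) (by rw [neg_zsmul]; linarith)
    have heq : z = w + n • a := by
      rw [neg_zsmul] at h2; linarith
    have hn : toIcoMod ha 0 z = toIcoMod ha 0 w := by rw [heq, toIcoMod_add_zsmul]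
    rwa [(toIcoMod_eq_self ha).2 (by simpa using hz.1),
      (toIcoMod_eq_self ha).2 (by simpa using hw.1)] at hn

/-- For `V` real-analytic, `a`-periodic and even: if `f`, `g` are periodic eigenfunctions
for eigenvalues `lam < μ` satisfying *different* initial conditions (one vanishes at `0`,
the other has vanishing derivative at `0`), then `g` has at least as many zeros in `[0,a)`
as `f` does. -/
theorem different_initial_conditions_node_monotone (a : ℝ) (ha : 0 < a) (V : ℝ → ℝ)
    (hV : AnalyticOnNhd ℝ V Set.univ) (hVper : ∀ x : ℝ, V (x + a) = V x)
    (hVeven : ∀ x : ℝ, V (-x) = V x) (lam μ : ℝ) (hlt : lam < μ) (f g : ℝ → ℝ)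
    (hf : IsPeriodicEigenfunction a V lam f) (hg : IsPeriodicEigenfunction a V μ g)
    (hdiff : (f 0 = 0 ∧ deriv g 0 = 0) ∨ (deriv f 0 = 0 ∧ g 0 = 0)) :
    {x : ℝ | x ∈ Set.Ico 0 a ∧ f x = 0}.ncard ≤
      {x : ℝ | x ∈ Set.Ico 0 a ∧ g x = 0}.ncard := by
  have hVc : Continuous V := continuousOn_univ.1 hV.continuousOn
  have hbdd : ∀ c : ℝ, ∃ C, ∀ x, |V x + c| ≤ C := by
    intro c
    have hper : Function.Periodic (fun x => V x + c) a := fun x => by simp only [hVper x]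
    obtain ⟨C, hC⟩ := (hper.isBounded_of_continuous ha.ne'
      (hVc.add continuous_const)).exists_norm_le
    exact ⟨C, fun x => hC _ (mem_range_self x)⟩
  have hder : ∀ {c : ℝ} {h : ℝ → ℝ}, IsPeriodicEigenfunction a V c h →
      (∀ x, HasDerivAt h (deriv h x) x) ∧
        ∀ x, HasDerivAt (deriv h) (-(V x + c) * h x) x := by
    intro c h hh
    have hh2 : ContDiff ℝ 2 h := contDiff_infty.1 hh.1 2
    refine ⟨fun x => (hh2.differentiable (by norm_num) x).hasDerivAt, fun x => ?_⟩
    have hd := (hh2.differentiable_deriv_two x).hasDerivAt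
    rwa [show deriv (deriv h) x = -(V x + c) * h x by linarith [hh.2.2.1 x]] at hd
  have hfin : ∀ {c : ℝ} {h : ℝ → ℝ}, IsPeriodicEigenfunction a V c h →
      ∀ u v : ℝ, {x | x ∈ Icc u v ∧ h x = 0}.Finite := by
    intro c h hh u v
    obtain ⟨C, hC⟩ := hbdd c
    exact finite_zeros_of_second_order_linear (q := fun x => V x + c) (hder hh).1 (hder hh).2 hC
      hh.2.1 isCompact_Icc
  refine ncard_zeros_le_of_interlacing ha hf.2.2.2 hg.2.2.2 (hfin hf)
    ((hfin hg 0 a).subset fun x hx => ⟨Ico_subset_Icc_self hx.1, hx.2⟩)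
    fun u v huv hu hv hne => ?_
  exact sturm_comparison (p := fun x => V x + lam) (q := fun x => V x + μ) (hder hf).1 (hder hf).2
    (hder hg).1 (hder hg).2 (fun x => by linarith) huv hu hv hne
end
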